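/- For potential flow with Bernoulli relation h − h0 = |u0|²(1−ξ)(1+V/V0)/2 and h a smooth function of V with h_V < 0, the map V ↦ ξ(V) = 1 − 2(h(V)−h0)/(|u0|²(1+V/V0)) has strictly positive derivative at every V < V0, hence is strictly increasing on any interval of V < V0. -/

import Mathlib

/-- Potential flow polar parametrization: with `h` smooth on `(0,∞)` and
`h' < 0` on `(0, V0]`, the map
`V ↦ ξ(V) = 1 − 2(h(V) − h(V0))/(|u0|²(1 + V/V0))` has strictly positive
derivative at every `0 < V < V0`, hence is strictly increasing there.
Here `q = |u0|² > 0`. -/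
theorem stmt17 (V0 q : ℝ) (hV0 : 0 < V0) (hq : 0 < q) (h : ℝ → ℝ)
    (hsmooth : ContDiffOn ℝ (⊤ : ℕ∞) h (Set.Ioi 0))
    (hdv : ∀ V ∈ Set.Ioc (0 : ℝ) V0, deriv h V < 0) :
    (∀ V ∈ Set.Ioo (0 : ℝ) V0,
        0 < deriv (fun V' => 1 - 2 * (h V' - h V0) / (q * (1 + V' / V0))) V) ∧
      StrictMonoOn (fun V' => 1 - 2 * (h V' - h V0) / (q * (1 + V' / V0)))
        (Set.Ioo (0 : ℝ) V0) := by
  have hd : ∀ V, 0 < V → DifferentiableAt ℝ h V := fun V hV =>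
    (hsmooth.contDiffAt (Ioi_mem_nhds hV)).differentiableAt (by simp)
  have hanti : StrictAntiOn h (Set.Ioc 0 V0) := by
    apply strictAntiOn_of_deriv_neg (convex_Ioc 0 V0)
    · intro x hx
      exact (hd x hx.1).continuousAt.continuousWithinAt
    · intro x hx
      exact hdv x (interior_subset hx)
  have hD : ∀ V ∈ Set.Ioo (0 : ℝ) V0, ∃ D, 0 < D ∧
      HasDerivAt (fun V' => 1 - 2 * (h V' - h V0) / (q * (1 + V' / V0))) D V := by
    intro V hV
    have hden : 0 < q * (1 + V / V0) := by
      have := div_pos hV.1 hV0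
      positivity
    have h1 : HasDerivAt (fun V' => 2 * (h V' - h V0)) (2 * deriv h V) V :=
      ((hd V hV.1).hasDerivAt.sub_const _).const_mul 2
    have h2 : HasDerivAt (fun V' => q * (1 + V' / V0)) (q * (1 / V0)) V :=
      (((hasDerivAt_id V).div_const V0).const_add 1).const_mul q
    refine ⟨_, ?_, (h1.div h2 hden.ne').const_sub 1⟩
    have h3 : h V0 < h V := hanti ⟨hV.1, hV.2.le⟩ ⟨hV0, le_rfl⟩ hV.2
    have h4 := hdv V ⟨hV.1, hV.2.le⟩
    rw [neg_pos]
    apply div_neg_of_neg_of_pos _ (by positivity)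
    have h5 : 2 * deriv h V * (q * (1 + V / V0)) < 0 :=
      mul_neg_of_neg_of_pos (by linarith) hden
    have h6 : 0 < 2 * (h V - h V0) * (q * (1 / V0)) :=
      mul_pos (by linarith) (by positivity)
    linarith
  have hpos : ∀ V ∈ Set.Ioo (0 : ℝ) V0,
      0 < deriv (fun V' => 1 - 2 * (h V' - h V0) / (q * (1 + V' / V0))) V := by
    intro V hV
    obtain ⟨D, hDp, hDd⟩ := hD V hV
    rw [hDd.deriv]
    exact hDp
  refine ⟨hpos, strictMonoOn_of_deriv_pos (convex_Ioo 0 V0) ?_ ?_⟩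
  · intro V hV
    obtain ⟨D, _, hDd⟩ := hD V hV
    exact hDd.continuousAt.continuousWithinAt
  · intro V hV
    exact hpos V (interior_subset hV)
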